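/- arXiv:2511.02305 — 2 statements merged into one kernel-verified Lean document; each statement's English description precedes it below -/
import Mathlib

section
/- Let p and q be polynomials with complex coefficients such that every zero a₁,…,aₙ of q lies in the open unit disk 𝔻, and set f = p/q and B(z) = ∏_{k=1}^{n} (z−a_k)/(1−conj(a_k)z). Then for every integer m ≥ 0, the function z ↦ f(z)·(d/dz)(B(z)²·zᵐ), defined on {z ∈ 𝔻 : q(z) ≠ 0}, extends to a bounded analytic function on 𝔻; in particular B(z)²·zᵐ lies in the domain of the restricted Liouville operator A_{f|B²H²}. -/
open Complex Metric Polynomial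

/-- The Blaschke factor with zero `a`. -/
noncomputable def blaschkeF (a z : ℂ) : ℂ := (z - a) / (1 - (starRingEnd ℂ) a * z)

/-- The finite Blaschke product whose zeros are the roots of `q` (with multiplicity). -/
noncomputable def blaschkeProdP (q : Polynomial ℂ) (z : ℂ) : ℂ :=
  (q.roots.map (fun a => blaschkeF a z)).prod

/-- The denominator of the Blaschke product, normalised so that `q` is the numerator. -/
noncomputable def blaschkeDenom (q : Polynomial ℂ) : Polynomial ℂ :=
  C q.leadingCoeff * (q.roots.map (fun a => 1 - C ((starRingEnd ℂ) a) * X)).prod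

theorem blaschkeProdP_eq_div (q : Polynomial ℂ) (hq : q ≠ 0) (z : ℂ) :
    blaschkeProdP q z = q.eval z / (blaschkeDenom q).eval z := by
  have hnum : q.eval z = q.leadingCoeff * (q.roots.map (fun a => z - a)).prod := by
    conv_lhs => rw [(IsAlgClosed.splits q).eq_prod_roots]
    simp [eval_multiset_prod, Multiset.map_map]
  have hden : (blaschkeDenom q).eval z =
      q.leadingCoeff * (q.roots.map (fun a => 1 - (starRingEnd ℂ) a * z)).prod := by
    simp [blaschkeDenom, eval_multiset_prod, Multiset.map_map]
  rw [hnum, hden, mul_div_mul_left _ _ (leadingCoeff_ne_zero.mpr hq),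
    ← Multiset.prod_map_div]
  rfl

theorem blaschkeDenom_eval_ne_zero {q : Polynomial ℂ} (hq : q ≠ 0)
    (hroots : ∀ a ∈ q.roots, ‖a‖ < 1) {z : ℂ} (hz : ‖z‖ ≤ 1) :
    (blaschkeDenom q).eval z ≠ 0 := by
  simp only [blaschkeDenom, eval_mul, eval_C, eval_multiset_prod, Multiset.map_map,
    Function.comp_def, eval_sub, eval_one, eval_X]
  refine mul_ne_zero (leadingCoeff_ne_zero.mpr hq) (Multiset.prod_ne_zero fun h => ?_)
  obtain ⟨a, ha, h0⟩ := Multiset.mem_map.mp h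
  have hlt : ‖(starRingEnd ℂ) a * z‖ < 1 := by
    rw [norm_mul, RCLike.norm_conj]
    exact (mul_le_of_le_one_right (norm_nonneg a) hz).trans_lt (hroots a ha)
  rw [← sub_eq_zero.mp h0, norm_one] at hlt
  exact lt_irrefl 1 hlt

/-- The derivative of `(q / e)² zᵐ` is `q` times a polynomial, divided by `e³`. -/
theorem deriv_div_sq_mul_pow (q e : Polynomial ℂ) (m : ℕ) {z : ℂ} (hz : e.eval z ≠ 0) :
    deriv (fun w => (q.eval w / e.eval w) ^ 2 * w ^ m) z =
      q.eval z * (2 * (derivative q * e - q * derivative e) * X ^ m +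
        q * e * derivative (X ^ m)).eval z / e.eval z ^ 3 := by
  have h := (((q.hasDerivAt z).fun_div (e.hasDerivAt z) hz).fun_pow 2).fun_mul
    ((X ^ m : Polynomial ℂ).hasDerivAt z)
  simp only [eval_pow, eval_X] at h
  rw [h.deriv]
  simp only [eval_add, eval_mul, eval_sub, eval_pow, eval_X, eval_ofNat]
  push_cast
  field_simp

/-- with `f = p/q` where all zeros of `q` lie in the open unit disk and
`B` the associated finite Blaschke product, for every `m ≥ 0` the function
`z ↦ f(z) · d/dz (B(z)² zᵐ)`, defined on `{z ∈ 𝔻 : q(z) ≠ 0}`, extends to a bounded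
analytic function on `𝔻`; in particular `B² zᵐ` is in the domain of the restricted
Liouville operator. -/
theorem stmt0 (p q : Polynomial ℂ) (hq : q ≠ 0)
    (hroots : ∀ a ∈ q.roots, ‖a‖ < 1) (m : ℕ) :
    ∃ F : ℂ → ℂ, AnalyticOnNhd ℂ F (ball (0 : ℂ) 1) ∧
      (∃ C : ℝ, ∀ z ∈ ball (0 : ℂ) 1, ‖F z‖ ≤ C) ∧
      ∀ z ∈ ball (0 : ℂ) 1, q.eval z ≠ 0 →
        F z = (p.eval z / q.eval z) *
          deriv (fun w => (blaschkeProdP q w) ^ 2 * w ^ m) z := by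
  set e := blaschkeDenom q
  set r := 2 * (derivative q * e - q * derivative e) * X ^ m + q * e * derivative (X ^ m)
  have he : ∀ z ∈ closedBall (0 : ℂ) 1, e.eval z ^ 3 ≠ 0 := fun z hz =>
    pow_ne_zero 3 (blaschkeDenom_eval_ne_zero hq hroots (mem_closedBall_zero_iff.mp hz))
  refine ⟨fun z => (p * r).eval z / e.eval z ^ 3, ?_, ?_, ?_⟩
  · refine DifferentiableOn.analyticOnNhd ?_ isOpen_ball
    exact (p * r).differentiable.differentiableOn.div (e.differentiable.pow 3).differentiableOn
      fun z hz => he z (ball_subset_closedBall hz)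
  · obtain ⟨c, hc⟩ := (isCompact_closedBall (0 : ℂ) 1).exists_bound_of_continuousOn
      ((p * r).continuous.continuousOn.div (e.continuous.pow 3).continuousOn he)
    exact ⟨c, fun z hz => hc z (ball_subset_closedBall hz)⟩
  · intro z hz hqz
    have hez : e.eval z ≠ 0 :=
      blaschkeDenom_eval_ne_zero hq hroots (mem_ball_zero_iff.mp hz).le
    have hB : blaschkeProdP q = fun w => q.eval w / e.eval w :=
      funext (blaschkeProdP_eq_div q hq)
    simp only [hB]
    rw [deriv_div_sq_mul_pow q e m hez, eval_mul]
    field_simp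
    rfl
end

section
/- Let p and q be polynomials with complex coefficients such that every zero a₁,…,aₙ of q lies in 𝔻, set f = p/q and B(z) = ∏_{k=1}^{n} (z−a_k)/(1−conj(a_k)z). Let T > 0 and let γ : [0,T] → 𝔻 be a differentiable trajectory with q(γ(t)) ≠ 0 and γ′(t) = f(γ(t)) for all t ∈ [0,T]. Then for every g ∈ H²(𝔻), ∫₀ᵀ f(γ(t))·(B²g)′(γ(t)) dt = ⟨B²g, K_{B²}(γ(T),·) − K_{B²}(γ(0),·)⟩_{H²}, where K_{B²}(w,z) = conj(B(w)²)·B(z)²/(1−conj(w)z). Equivalently, the adjoint of the restricted Liouville operator maps the occupation kernel Γ_γ to K_{B²}(γ(T),·) − K_{B²}(γ(0),·). -/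
open Complex Metric Polynomial

/-- The reproducing kernel of `B²H²`: `K_{B²}(w,z) = conj(B(w)²) B(z)² / (1 − conj(w) z)`. -/
noncomputable def KB2 (q : Polynomial ℂ) (w z : ℂ) : ℂ :=
  (starRingEnd ℂ) ((blaschkeProdP q w) ^ 2) * (blaschkeProdP q z) ^ 2 /
    (1 - (starRingEnd ℂ) w * z)

/-- `g` is a member of the Hardy space `H²(𝔻)` with Taylor coefficient sequence `c`. -/
def IsHardy2 (g : ℂ → ℂ) (c : ℕ → ℂ) : Prop :=
  (∀ z ∈ Metric.ball (0 : ℂ) 1, HasSum (fun n => c n * z ^ n) (g z)) ∧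
  Summable (fun n => ‖c n‖ ^ 2)

section Hardy

open scoped InnerProductSpace ComplexConjugate

/-- Square-summable coefficient sequences. -/
local notation "ℓ²" => lp (fun _ : ℕ => ℂ) 2

private lemma memlp_two_of_summable {c : ℕ → ℂ} (hc : Summable fun n => ‖c n‖ ^ 2) :
    Memℓp c 2 :=
  memℓp_gen (by simpa using hc)

private lemma lp_two_summable_sq (c : ℓ²) : Summable fun n => ‖c n‖ ^ 2 := by
  simpa using (lp.memℓp c).summable (by simp)

private lemma lp_two_norm_sq (c : ℓ²) : ‖c‖ ^ 2 = ∑' n, ‖c n‖ ^ 2 := by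
  simpa using lp.norm_rpow_eq_tsum (p := 2) (by simp) c

/-- The right shift of a sequence. -/
private def shiftSeq (c : ℕ → ℂ) : ℕ → ℂ
  | 0 => 0
  | n + 1 => c n

private lemma shiftSeq_summable_sq (c : ℓ²) : Summable fun n => ‖shiftSeq c n‖ ^ 2 :=
  (summable_nat_add_iff 1).mp (by simpa [shiftSeq] using lp_two_summable_sq c)

/-- The unilateral shift on square-summable sequences. -/
private noncomputable def shift : ℓ² →ₗᵢ[ℂ] ℓ² where
  toFun c := ⟨shiftSeq c, memlp_two_of_summable (shiftSeq_summable_sq c)⟩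
  map_add' c d := by
    ext n
    cases n
    · exact (add_zero (0 : ℂ)).symm
    · rfl
  map_smul' r c := by
    ext n
    cases n <;> simp [shiftSeq]
  norm_map' c := by
    rw [← sq_eq_sq₀ (norm_nonneg _) (norm_nonneg _), lp_two_norm_sq, lp_two_norm_sq]
    exact ((shiftSeq_summable_sq c).tsum_eq_zero_add).trans (by simp [shiftSeq])

private lemma summable_norm_pow_sq {w : ℂ} (hw : ‖w‖ < 1) :
    Summable fun n : ℕ => ‖w ^ n‖ ^ 2 := by
  have h : Summable fun n : ℕ => (‖w‖ ^ 2) ^ n :=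
    summable_geometric_of_lt_one (by positivity) (pow_lt_one₀ (norm_nonneg _) hw two_ne_zero)
  refine h.congr fun n => ?_
  rw [norm_pow, ← pow_mul, ← pow_mul, mul_comm]

/-- The Szegő kernel at `w`, as a sequence of Taylor coefficients. -/
private noncomputable def szego (w : ℂ) (hw : ‖w‖ < 1) : ℓ² :=
  ⟨fun n => conj w ^ n, memlp_two_of_summable (summable_norm_pow_sq (by simpa using hw))⟩

private lemma hasSum_szego {w : ℂ} (hw : ‖w‖ < 1) (c : ℓ²) :
    HasSum (fun n => c n * w ^ n) ⟪szego w hw, c⟫_ℂ := by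
  simpa [szego, RCLike.inner_apply] using lp.hasSum_inner (𝕜 := ℂ) (szego w hw) c

private lemma inner_szego_szego {w z : ℂ} (hw : ‖w‖ < 1) (hz : ‖z‖ < 1) :
    ⟪szego z hz, szego w hw⟫_ℂ = (1 - conj w * z)⁻¹ := by
  refine (hasSum_szego hz (szego w hw)).unique ?_
  have h : ‖conj w * z‖ < 1 := by
    rw [norm_mul, RCLike.norm_conj]
    exact mul_lt_one_of_nonneg_of_lt_one_left (norm_nonneg _) hw hz.le
  simpa [szego, mul_pow] using hasSum_geometric_of_norm_lt_one h

private lemma inner_szego_shift {w : ℂ} (hw : ‖w‖ < 1) (c : ℓ²) :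
    ⟪szego w hw, shift c⟫_ℂ = w * ⟪szego w hw, c⟫_ℂ := by
  refine (hasSum_szego hw (shift c)).unique ?_
  rw [← hasSum_nat_add_iff' 1]
  have h0 : (shift c : ℓ²) 0 = 0 := rfl
  have h1 : ∀ n, (shift c : ℓ²) (n + 1) = c n := fun _ => rfl
  simp only [Finset.sum_range_one, h0, h1, zero_mul, sub_zero]
  simpa only [pow_succ', mul_left_comm] using (hasSum_szego hw c).mul_left w

private lemma one_sub_conj_mul_ne_zero {a z : ℂ} (ha : ‖a‖ < 1) (hz : ‖z‖ < 1) :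
    1 - conj a * z ≠ 0 := by
  intro h
  have h' : ‖conj a * z‖ < 1 := by
    rw [norm_mul, RCLike.norm_conj]
    exact mul_lt_one_of_nonneg_of_lt_one_left (norm_nonneg _) ha hz.le
  rw [← sub_eq_zero.mp h] at h'
  simp at h'

/-- Multiplication by a Blaschke factor is an isometry of the Hardy space. -/
private lemma exists_isometry_blaschkeF {a : ℂ} (ha : ‖a‖ < 1) :
    ∃ V : ℓ² →ₗᵢ[ℂ] ℓ², ∀ (z : ℂ) (hz : ‖z‖ < 1) (c : ℓ²),
      ⟪szego z hz, V c⟫_ℂ = blaschkeF a z * ⟪szego z hz, c⟫_ℂ := by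
  let S : ℓ² →L[ℂ] ℓ² := shift.toContinuousLinearMap
  have hS : ‖conj a • S‖ < 1 := by
    rw [norm_smul, RCLike.norm_conj]
    exact mul_lt_one_of_nonneg_of_lt_one_left (norm_nonneg _) ha
      shift.norm_toContinuousLinearMap_le
  let U := Units.oneSub (conj a • S) hS
  have hU : ∀ c, (U⁻¹.val c) - conj a • shift (U⁻¹.val c) = c := fun c => by
    have h := congrArg (fun A : ℓ² →L[ℂ] ℓ² => A c) U.mul_inv
    simpa [U, S] using h
  let W : ℓ² →L[ℂ] ℓ² := (S - a • 1) * U⁻¹.val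
  have hW : ∀ c, W c = shift (U⁻¹.val c) - a • U⁻¹.val c := fun c => by simp [W, S]
  refine ⟨⟨W.toLinearMap, fun c => ?_⟩, fun z hz c => ?_⟩
  · change ‖W c‖ = ‖c‖
    rw [hW]
    conv_rhs => rw [← hU c]
    generalize U⁻¹.val c = u
    rw [← sq_eq_sq₀ (norm_nonneg _) (norm_nonneg _), @norm_sub_sq ℂ, @norm_sub_sq ℂ]
    have h : RCLike.re ⟪shift u, a • u⟫_ℂ = RCLike.re ⟪u, conj a • shift u⟫_ℂ := by
      rw [inner_smul_right, inner_smul_right, ← inner_conj_symm (shift u) u, ← RCLike.conj_re]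
      simp only [map_mul, RCLike.conj_conj]
    rw [h]
    simp only [norm_smul, RCLike.norm_conj, LinearIsometry.norm_map]
  · change ⟪szego z hz, W c⟫_ℂ = _
    rw [hW]
    conv_rhs => rw [← hU c]
    generalize U⁻¹.val c = u
    have h := one_sub_conj_mul_ne_zero ha hz
    simp only [inner_sub_right, inner_smul_right, inner_szego_shift, blaschkeF]
    rw [div_mul_eq_mul_div, eq_div_iff h]
    ring

/-- Multiplication by a finite Blaschke product is an isometry of the Hardy space. -/
private lemma exists_isometry_blaschke_prod (s : Multiset ℂ) (hs : ∀ a ∈ s, ‖a‖ < 1) :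
    ∃ V : ℓ² →ₗᵢ[ℂ] ℓ², ∀ (z : ℂ) (hz : ‖z‖ < 1) (c : ℓ²),
      ⟪szego z hz, V c⟫_ℂ = (s.map fun a => blaschkeF a z).prod * ⟪szego z hz, c⟫_ℂ := by
  induction s using Multiset.induction_on with
  | empty => exact ⟨LinearIsometry.id, by simp⟩
  | cons a s ih =>
    obtain ⟨V, hV⟩ := ih fun b hb => hs b (Multiset.mem_cons_of_mem hb)
    obtain ⟨A, hA⟩ := exists_isometry_blaschkeF (hs a (Multiset.mem_cons_self a s))
    exact ⟨A.comp V, fun z hz c => by simp [hA, hV, mul_assoc]⟩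

private lemma IsHardy2.hasFPowerSeriesOnBall {g : ℂ → ℂ} {c : ℕ → ℂ} (h : IsHardy2 g c) :
    HasFPowerSeriesOnBall g (FormalMultilinearSeries.ofScalars ℂ c) 0 1 where
  r_le := by
    obtain ⟨C, hC⟩ := h.2.tendsto_atTop_zero.bddAbove_range
    refine FormalMultilinearSeries.le_radius_of_bound (r := 1) _ (C + 1) fun n => ?_
    have h1 : ‖c n‖ ^ 2 ≤ C := hC ⟨n, rfl⟩
    simp only [FormalMultilinearSeries.ofScalars_norm, NNReal.coe_one, one_pow, mul_one]
    nlinarith [sq_nonneg (‖c n‖ - 1)]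
  r_pos := one_pos
  hasSum {y} hy := by
    have hy' : y ∈ Metric.ball (0 : ℂ) 1 := by
      simpa [← Metric.eball_ofReal] using hy
    simpa [FormalMultilinearSeries.ofScalars_apply_eq, mul_comm] using h.1 y hy'

private lemma IsHardy2.coeff_unique {g : ℂ → ℂ} {c d : ℕ → ℂ} (hc : IsHardy2 g c)
    (hd : IsHardy2 g d) : c = d := by
  have h := hc.hasFPowerSeriesOnBall.hasFPowerSeriesAt.eq_formalMultilinearSeries
    hd.hasFPowerSeriesOnBall.hasFPowerSeriesAt
  funext n
  simpa using congrArg (fun s => FormalMultilinearSeries.coeff s n) h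

private lemma IsHardy2.eq_of_inner {g : ℂ → ℂ} {c : ℕ → ℂ} (hc : IsHardy2 g c) (d : ℓ²)
    (h : ∀ (z : ℂ) (hz : ‖z‖ < 1), ⟪szego z hz, d⟫_ℂ = g z) : c = d := by
  refine hc.coeff_unique ⟨fun z hz => ?_, lp_two_summable_sq d⟩
  have hz' : ‖z‖ < 1 := by simpa using hz
  rw [← h z hz']
  exact hasSum_szego hz' d

private lemma tsum_mul_conj_eq_sub {q : ℂ[X]} (hroots : ∀ a ∈ q.roots, ‖a‖ < 1) {v w : ℂ}
    (hv : ‖v‖ < 1) (hw : ‖w‖ < 1) {g : ℂ → ℂ} {cg d e : ℕ → ℂ} (hg : IsHardy2 g cg)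
    (hd : IsHardy2 (fun z => (blaschkeProdP q z) ^ 2 * g z) d)
    (he : IsHardy2 (fun z => KB2 q w z - KB2 q v z) e) :
    ∑' m, d m * conj (e m) =
      (blaschkeProdP q w) ^ 2 * g w - (blaschkeProdP q v) ^ 2 * g v := by
  obtain ⟨A, hA⟩ := exists_isometry_blaschke_prod q.roots hroots
  let V := A.comp A
  have hV : ∀ (z : ℂ) (hz : ‖z‖ < 1) (c : ℓ²),
      ⟪szego z hz, V c⟫_ℂ = (blaschkeProdP q z) ^ 2 * ⟪szego z hz, c⟫_ℂ := fun z hz c => by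
    simp [V, hA, blaschkeProdP, sq, mul_assoc]
  let G : ℓ² := ⟨cg, memlp_two_of_summable hg.2⟩
  have hG : ∀ (z : ℂ) (hz : ‖z‖ < 1), ⟪szego z hz, G⟫_ℂ = g z := fun z hz =>
    (hasSum_szego hz G).unique (hg.1 z (by simpa using hz))
  have hd' : d = V G := hd.eq_of_inner _ fun z hz => by rw [hV, hG]
  have he' : e = (conj ((blaschkeProdP q w) ^ 2) • V (szego w hw) -
      conj ((blaschkeProdP q v) ^ 2) • V (szego v hv) : ℓ²) := by
    refine he.eq_of_inner _ fun z hz => ?_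
    rw [inner_sub_right, inner_smul_right, inner_smul_right, hV, hV, inner_szego_szego,
      inner_szego_szego, KB2, KB2]
    ring
  rw [hd', he']
  refine Eq.trans (lp.inner_eq_tsum (𝕜 := ℂ) _ (V G)).symm ?_
  rw [inner_sub_left, inner_smul_left, inner_smul_left, V.inner_map_map, V.inner_map_map, hG, hG,
    starRingEnd_self_apply, starRingEnd_self_apply]

end Hardy

/-- if `γ : [0,T] → 𝔻` solves `γ′ = f(γ)` with `f = p/q` (zeros of `q`
in `𝔻`, avoided by `γ`), then for every `g ∈ H²(𝔻)`,
`∫₀ᵀ f(γ(t)) (B²g)′(γ(t)) dt = ⟨B²g, K_{B²}(γ(T),·) − K_{B²}(γ(0),·)⟩_{H²}`;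
i.e. the adjoint of the restricted Liouville operator maps the occupation kernel
`Γ_γ` to `K_{B²}(γ(T),·) − K_{B²}(γ(0),·)`. -/
theorem stmt8 (p q : Polynomial ℂ) (hq : q ≠ 0)
    (hroots : ∀ a ∈ q.roots, ‖a‖ < 1)
    (T : ℝ) (hT : 0 < T) (γ : ℝ → ℂ)
    (hγd : ∀ t ∈ Set.Icc (0 : ℝ) T, ‖γ t‖ < 1)
    (hγq : ∀ t ∈ Set.Icc (0 : ℝ) T, q.eval (γ t) ≠ 0)
    (hγ : ∀ t ∈ Set.Icc (0 : ℝ) T, HasDerivAt γ (p.eval (γ t) / q.eval (γ t)) t)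
    (g : ℂ → ℂ) (cg : ℕ → ℂ) (hg : IsHardy2 g cg)
    (d e : ℕ → ℂ)
    (hd : IsHardy2 (fun z => (blaschkeProdP q z) ^ 2 * g z) d)
    (he : IsHardy2 (fun z => KB2 q (γ T) z - KB2 q (γ 0) z) e) :
    (∫ t in (0 : ℝ)..T, (p.eval (γ t) / q.eval (γ t)) *
        deriv (fun z => (blaschkeProdP q z) ^ 2 * g z) (γ t)) =
      ∑' m, d m * (starRingEnd ℂ) (e m) := by
  have hI : Set.uIcc (0 : ℝ) T = Set.Icc 0 T := Set.uIcc_of_le hT.le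
  rw [tsum_mul_conj_eq_sub hroots (hγd 0 ⟨le_rfl, hT.le⟩) (hγd T ⟨hT.le, le_rfl⟩) hg hd he]
  set F : ℂ → ℂ := fun z => (blaschkeProdP q z) ^ 2 * g z
  have hFa : ∀ t ∈ Set.Icc (0 : ℝ) T, AnalyticAt ℂ F (γ t) := fun t ht =>
    hd.hasFPowerSeriesOnBall.analyticAt_of_mem (by
      rw [← ENNReal.ofReal_one, Metric.eball_ofReal]
      simpa using hγd t ht)
  have hγc : ContinuousOn γ (Set.Icc 0 T) := fun t ht =>
    (hγ t ht).continuousAt.continuousWithinAt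
  refine intervalIntegral.integral_eq_sub_of_hasDerivAt (f := fun t => F (γ t))
    (fun t ht => ?_) (ContinuousOn.intervalIntegrable ?_)
  · rw [hI] at ht
    rw [mul_comm]
    exact (hFa t ht).differentiableAt.hasDerivAt.comp t (hγ t ht)
  · rw [hI]
    refine ContinuousOn.mul (ContinuousOn.div ?_ ?_ hγq) fun t ht => ?_
    · exact p.continuous.comp_continuousOn hγc
    · exact q.continuous.comp_continuousOn hγc
    · exact (hFa t ht).deriv.continuousAt.comp_continuousWithinAt (hγc t ht)
end
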